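/- arXiv:2410.09251 — 3 statements merged into one kernel-verified Lean document; each statement's English description precedes it below -/
import Mathlib

section
/- Let M be a commutative cancellative monoid (written additively). If M satisfies the ascending chain condition on principal ideals (ACCP), then M is a strong MCD monoid, i.e., every nonempty subset of M has a maximal common divisor. -/
/-- `c` divides `b` in the additive monoid `M`, i.e., `b = c + d` for some `d ∈ M`. -/
def DvdIn {M : Type*} [AddCommMonoid M] (c b : M) : Prop := ∃ d, b = c + d

/-- `d` is a maximal common divisor of the subset `S` of `M`: `d` is a common divisor of
`S`, and every common divisor of `{s - d : s ∈ S}` is invertible in `M`. -/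
def IsMCD {M : Type*} [AddCommMonoid M] (d : M) (S : Set M) : Prop :=
  (∀ s ∈ S, DvdIn d s) ∧
    ∀ e : M, (∀ s ∈ S, ∀ t : M, s = d + t → DvdIn e t) → IsAddUnit e

/-- `M` is a strong MCD monoid: every nonempty subset of `M` has a maximal common divisor. -/
def StronglyMCD (M : Type*) [AddCommMonoid M] : Prop :=
  ∀ S : Set M, S.Nonempty → ∃ d, IsMCD d S

/-- The principal ideal `b + M` of `M`. -/
def PIdeal {M : Type*} [AddCommMonoid M] (b : M) : Set M := {x | DvdIn b x}

/-- `M` satisfies the ascending chain condition on principal ideals. -/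
def SatisfiesACCP (M : Type*) [AddCommMonoid M] : Prop :=
  ∀ b : ℕ → M, (∀ n, PIdeal (b n) ⊆ PIdeal (b (n + 1))) →
    ∃ N, ∀ n, N ≤ n → PIdeal (b n) = PIdeal (b N)

/-- In a cancellative monoid satisfying the ACCP, proper divisibility is well-founded. -/
theorem SatisfiesACCP.wellFounded_properDvd {M : Type*} [AddCancelCommMonoid M]
    (h : SatisfiesACCP M) :
    WellFounded fun c b : M => ∃ e, b = c + e ∧ ¬ IsAddUnit e := by
  rw [wellFounded_iff_isEmpty_descending_chain]
  refine ⟨fun ⟨b, hb⟩ => ?_⟩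
  obtain ⟨N, hN⟩ := h b fun n x ⟨y, hy⟩ => by
    obtain ⟨e, he, -⟩ := hb n
    exact ⟨e + y, by rw [hy, he, add_assoc]⟩
  obtain ⟨e, he, hunit⟩ := hb N
  have hmem : b (N + 1) ∈ PIdeal (b N) := by
    rw [← hN (N + 1) N.le_succ]
    exact ⟨0, (add_zero _).symm⟩
  obtain ⟨x, hx⟩ := hmem
  rw [he, add_assoc, left_eq_add] at hx
  exact hunit (IsAddUnit.of_add_eq_zero x hx)

/-- Every commutative cancellative monoid satisfying the ACCP is a strong MCD monoid. -/
theorem accp_implies_stronglyMCD (M : Type*) [AddCancelCommMonoid M]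
    (h : SatisfiesACCP M) : StronglyMCD M := by
  rintro S ⟨s₀, hs₀⟩
  obtain ⟨c, ⟨d, hd, hdc⟩, hmin⟩ := h.wellFounded_properDvd.has_min
    {c | ∃ d, (∀ s ∈ S, DvdIn d s) ∧ s₀ = d + c}
    ⟨s₀, 0, fun s _ => ⟨s, (zero_add s).symm⟩, (zero_add s₀).symm⟩
  refine ⟨d, hd, fun e he => ?_⟩
  by_contra hunit
  obtain ⟨c', hc'⟩ := he s₀ hs₀ c hdc
  refine hmin c' ⟨d + e, fun s hs => ?_, by rw [hdc, hc', add_assoc]⟩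
    ⟨e, by rw [hc', add_comm], hunit⟩
  obtain ⟨t, ht⟩ := hd s hs
  obtain ⟨u, hu⟩ := he s hs t ht
  exact ⟨u, by rw [ht, hu, add_assoc]⟩
end

section
/- Let M be a countable commutative cancellative monoid (written additively). If M is strongly MCD, then M satisfies the ascending chain condition on principal ideals (ACCP). -/
/-- The element left of the chain `b` after its first `n` steps when only the steps `a i` with
`i ∈ A` are subtracted from `b 0`. -/
noncomputable def partialQuotient {M : Type*} [AddCommMonoid M] (b a : ℕ → M) (A : Set ℕ)
    (n : ℕ) : M :=
  open Classical in b n + ∑ i ∈ Finset.range n, if i ∈ A then 0 else a i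

theorem exists_partialQuotient_eq_add {M : Type*} [AddCommMonoid M] {b a : ℕ → M}
    (hab : ∀ n, b n = b (n + 1) + a n) (A : Set ℕ) {n m : ℕ} (hnm : n ≤ m) :
    ∃ y, partialQuotient b a A n = partialQuotient b a A m + y := by
  induction m, hnm using Nat.le_induction with
  | base => exact ⟨0, (add_zero _).symm⟩
  | succ m _ ih =>
    obtain ⟨y, hy⟩ := ih
    by_cases hm : m ∈ A
    · refine ⟨a m + y, ?_⟩
      rw [hy, partialQuotient, partialQuotient, Finset.sum_range_succ, if_pos hm, hab m]
      abel
    · refine ⟨y, ?_⟩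
      rw [hy, partialQuotient, partialQuotient, Finset.sum_range_succ, if_neg hm, hab m]
      abel

theorem exists_partialQuotient_eq_add_add {M : Type*} [AddCommMonoid M] (b a : ℕ → M)
    {A B : Set ℕ} (hAB : A ⊆ B) {k m : ℕ} (hkm : k < m) (hkA : k ∉ A) (hkB : k ∈ B) :
    ∃ y, partialQuotient b a A m = partialQuotient b a B m + (a k + y) := by
  classical
  have hsum : ∀ i, (if i ∈ A then 0 else a i) =
      (if i ∈ B then 0 else a i) + if i ∈ B \ A then a i else 0 := by
    intro i
    by_cases hA : i ∈ A
    · simp [hA, hAB hA]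
    · by_cases hB : i ∈ B <;> simp [hA, hB]
  refine ⟨∑ i ∈ (Finset.range m).erase k, if i ∈ B \ A then a i else 0, ?_⟩
  have hk := Finset.add_sum_erase (Finset.range m) (fun i => if i ∈ B \ A then a i else 0)
    (Finset.mem_range.2 hkm)
  have hkBA : k ∈ B \ A := ⟨hkB, hkA⟩
  simp only [if_pos hkBA] at hk
  rw [hk, partialQuotient, partialQuotient, Finset.sum_congr rfl fun i _ => hsum i,
    Finset.sum_add_distrib, add_assoc]

/-- Along two nested sets of steps that differ in `k`, a common value of the maximal common
divisor forces the step `a k` to be invertible. -/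
theorem isAddUnit_of_isMCD_partialQuotient {M : Type*} [AddCancelCommMonoid M] {b a : ℕ → M}
    (hab : ∀ n, b n = b (n + 1) + a n) {A B : Set ℕ} (hAB : A ⊆ B) {k : ℕ} (hkA : k ∉ A)
    (hkB : k ∈ B) {d : M} (hA : IsMCD d (Set.range (partialQuotient b a A)))
    (hB : IsMCD d (Set.range (partialQuotient b a B))) : IsAddUnit (a k) := by
  refine hA.2 _ ?_
  rintro _ ⟨n, rfl⟩ t ht
  obtain ⟨y, hy⟩ := exists_partialQuotient_eq_add hab A (le_max_left n (k + 1))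
  obtain ⟨z, hz⟩ := exists_partialQuotient_eq_add_add b a hAB
    (lt_of_lt_of_le k.lt_succ_self (le_max_right n (k + 1))) hkA hkB
  obtain ⟨t', ht'⟩ := hB.1 _ ⟨max n (k + 1), rfl⟩
  refine ⟨z + t' + y, add_left_cancel (a := d) ?_⟩
  rw [← ht, hy, hz, ht']
  abel

theorem pIdeal_add_eq_of_isAddUnit {M : Type*} [AddCommMonoid M] (c : M) {u : M}
    (hu : IsAddUnit u) : PIdeal (c + u) = PIdeal c := by
  obtain ⟨v, hv⟩ := hu.exists_neg
  ext x
  constructor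
  · rintro ⟨d, rfl⟩
    exact ⟨u + d, add_assoc _ _ _⟩
  · rintro ⟨d, rfl⟩
    refine ⟨v + d, ?_⟩
    rw [add_assoc, ← add_assoc u, hv, zero_add]

/-- Every countable commutative cancellative monoid that is strongly MCD satisfies
the ACCP. -/
theorem countable_stronglyMCD_implies_accp (M : Type*) [AddCancelCommMonoid M]
    [Countable M] (h : StronglyMCD M) : SatisfiesACCP M := by
  intro b hb
  have hdvd : ∀ n, ∃ a, b n = b (n + 1) + a := fun n => hb n ⟨0, (add_zero _).symm⟩
  choose a hab using hdvd
  by_cases hfin : {k | ¬ IsAddUnit (a k)}.Finite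
  · obtain ⟨N, hN⟩ := hfin.bddAbove
    refine ⟨N + 1, fun n hn => ?_⟩
    induction n, hn using Nat.le_induction with
    | base => rfl
    | succ n hn ih =>
      have hu : IsAddUnit (a n) := by
        by_contra hu
        have : n ≤ N := hN hu
        omega
      rw [← ih, hab n, pIdeal_add_eq_of_isAddUnit _ hu]
  · exfalso
    have : Infinite {k | ¬ IsAddUnit (a k)} := Set.infinite_coe_iff.2 hfin
    obtain ⟨e⟩ := nonempty_equiv_of_countable (α := ℚ) (β := {k | ¬ IsAddUnit (a k)})
    let A : ℝ → Set ℕ := fun r => {i | ∃ q : ℚ, (q : ℝ) < r ∧ (e q : ℕ) = i}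
    choose d hd using fun r => h (Set.range (partialQuotient b a (A r))) (Set.range_nonempty _)
    have key : ∀ r s, r < s → d r ≠ d s := by
      intro r s hrs heq
      obtain ⟨q, hrq, hqs⟩ := exists_rat_btwn hrs
      refine (e q).2 (isAddUnit_of_isMCD_partialQuotient hab (A := A r) (B := A s) ?_ ?_
        ⟨q, hqs, rfl⟩ (hd r) (heq ▸ hd s))
      · rintro _ ⟨p, hp, rfl⟩
        exact ⟨p, hp.trans hrs, rfl⟩
      · rintro ⟨p, hp, hpq⟩
        rw [e.injective (Subtype.ext hpq)] at hp
        exact lt_asymm hp hrq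
    have hinj : Function.Injective d := by
      intro r s hrs
      by_contra hne
      rcases lt_or_gt_of_ne hne with hlt | hlt
      · exact key r s hlt hrs
      · exact key s r hlt hrs.symm
    have : Countable ℝ := hinj.countable
    exact not_countable (α := ℝ) this
end

section
/- Let (p_n)_{n ≥ 1} be a strictly increasing sequence of primes, and let M be the Puiseux monoid generated by {1/(p_n p_{n+2}) : n ∈ ℕ}. Then every q ∈ M can be written as q = c + Σ_{i=−1}^{n−2} c_{i+2}·1/(p_i p_{i+2}), where n = max({0} ∪ {i ∈ ℕ : the p_i-adic valuation of q is negative}), the convention p_{−1} = p_0 = 1 is used, and c and all the coefficients c_1, ..., c_n are nonnegative integers. -/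
/-- The sequence of primes `(pₙ)` (here 0-indexed, so `p 0` plays the role of the first
prime `p₁` of the paper), extended by the convention `p₋₁ = p₀ = 1`: `pExt p (k + 1)`
is the paper's `p_k` for `k ≥ -1`, i.e. `pExt p 0 = p₋₁ = 1`, `pExt p 1 = p₀ = 1`, and
`pExt p (k + 2) = p_{k+1}`. -/
def pExt (p : ℕ → ℕ) : ℕ → ℚ
  | 0 => 1
  | 1 => 1
  | k + 2 => (p k : ℚ)

theorem exists_nat_pExt (p : ℕ → ℕ) (k : ℕ) : ∃ t : ℕ, pExt p k = t := by
  rcases k with _ | _ | k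
  · exact ⟨1, by simp [pExt]⟩
  · exact ⟨1, by simp [pExt]⟩
  · exact ⟨p k, rfl⟩

theorem pExt_ne_zero {p : ℕ → ℕ} (hp : ∀ n, (p n).Prime) (k : ℕ) : pExt p k ≠ 0 := by
  rcases k with _ | _ | k
  · simp [pExt]
  · simp [pExt]
  · exact Nat.cast_ne_zero.2 (hp k).ne_zero

theorem padicNorm_pExt_of_ne {p : ℕ → ℕ} (hp : ∀ n, (p n).Prime) (hinj : Function.Injective p)
    {N k : ℕ} (hk : k ≠ N + 2) : padicNorm (p N) (pExt p k) = 1 := by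
  rcases k with _ | _ | k
  · simp [pExt]
  · simp [pExt]
  · have := Fact.mk (hp N)
    have := Fact.mk (hp k)
    exact padicNorm.padicNorm_of_prime_of_ne fun h => hk (by rw [hinj h])

theorem padicNorm_le_one_of_padicValRat_nonneg {p : ℕ} [Fact p.Prime] {q : ℚ}
    (h : 0 ≤ padicValRat p q) : padicNorm p q ≤ 1 := by
  by_cases hq : q = 0
  · simp [hq]
  · rw [padicNorm.eq_zpow_of_nonzero hq]
    exact zpow_le_one_of_nonpos₀ (mod_cast (Fact.out : p.Prime).one_le) (by omega)

/-- If the `p N`-adic valuation of the sum is nonnegative, its last coefficient is divisible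
by `p N`, since no earlier term has `p N` in its denominator. -/
theorem dvd_last_coeff {p : ℕ → ℕ} (hp : ∀ n, (p n).Prime) (hinj : Function.Injective p)
    {q : ℚ} {N c : ℕ} {a : ℕ → ℕ} (hv : 0 ≤ padicValRat (p N) q)
    (hq : q = c + ∑ k ∈ Finset.range (N + 1), (a (k + 1) : ℚ) / (pExt p k * pExt p (k + 2))) :
    p N ∣ a (N + 1) := by
  have := Fact.mk (hp N)
  have hsum : padicNorm (p N)
      (∑ k ∈ Finset.range N, (a (k + 1) : ℚ) / (pExt p k * pExt p (k + 2))) ≤ 1 := by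
    refine padicNorm.sum_le' (fun k hk => ?_) zero_le_one
    have hk := Finset.mem_range.1 hk
    rw [padicNorm.div, padicNorm.mul, padicNorm_pExt_of_ne hp hinj (by omega),
      padicNorm_pExt_of_ne hp hinj (by omega), mul_one, div_one]
    exact padicNorm.of_nat _
  have hlast : padicNorm (p N) ((a (N + 1) : ℚ) / (pExt p N * pExt p (N + 2))) ≤ 1 := by
    rw [Finset.sum_range_succ] at hq
    rw [show (a (N + 1) : ℚ) / (pExt p N * pExt p (N + 2)) = q - (c +
      ∑ k ∈ Finset.range N, (a (k + 1) : ℚ) / (pExt p k * pExt p (k + 2))) by rw [hq]; ring]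
    exact padicNorm.sub.trans (max_le (padicNorm_le_one_of_padicValRat_nonneg hv)
      (padicNorm.nonarchimedean.trans (max_le (padicNorm.of_nat _) hsum)))
  rw [padicNorm.div, padicNorm.mul, padicNorm_pExt_of_ne hp hinj (by omega), one_mul,
    show pExt p (N + 2) = (p N : ℚ) from rfl] at hlast
  have hpos : 0 < padicNorm (p N) (p N : ℚ) := by
    rw [padicNorm.padicNorm_p_of_prime]
    exact inv_pos.2 (mod_cast (hp N).pos)
  rw [div_le_one hpos] at hlast
  exact (padicNorm.nat_lt_one_iff _).1
    (hlast.trans_lt padicNorm.padicNorm_p_lt_one_of_prime)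

/-- A multiple of `1 / pExt p N` is a nonnegative integer or can be absorbed into an earlier
term. -/
theorem exists_absorb_div_pExt {p : ℕ → ℕ} (hp : ∀ n, (p n).Prime) (N m c : ℕ) (a : ℕ → ℕ) :
    ∃ (c' : ℕ) (a' : ℕ → ℕ),
      c + ∑ k ∈ Finset.range N, (a (k + 1) : ℚ) / (pExt p k * pExt p (k + 2)) + m / pExt p N =
      c' + ∑ k ∈ Finset.range N, (a' (k + 1) : ℚ) / (pExt p k * pExt p (k + 2)) := by
  rcases N with _ | _ | j
  · exact ⟨c + m, a, by simp [pExt]⟩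
  · exact ⟨c + m, a, by simp [pExt]; ring⟩
  · obtain ⟨t, ht⟩ := exists_nat_pExt p j
    refine ⟨c, a + Pi.single (j + 1) (m * t), ?_⟩
    simp only [Pi.add_apply, Nat.cast_add, add_div, Finset.sum_add_distrib]
    rw [Finset.sum_eq_single (f := fun k => ((Pi.single (j + 1) (m * t) : ℕ → ℕ) (k + 1) : ℚ) /
      (pExt p k * pExt p (k + 2))) j]
    · have h₁ := pExt_ne_zero hp j
      have h₂ := pExt_ne_zero hp (j + 2)
      rw [Pi.single_eq_same, Nat.cast_mul, ← ht, mul_comm (m : ℚ), mul_div_mul_left _ _ h₁,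
        add_assoc]
    · intro k _ hk
      rw [Pi.single_eq_of_ne (by omega)]
      simp
    · intro h
      exact absurd (Finset.mem_range.2 (by omega)) h

theorem exists_sum_of_mem_closure {p : ℕ → ℕ} {q : ℚ}
    (hq : q ∈ AddSubmonoid.closure
      {q : ℚ | ∃ n : ℕ, q = 1 / ((p n : ℚ) * (p (n + 2) : ℚ))}) :
    ∃ N₀ : ℕ, ∀ N ≥ N₀, ∃ a : ℕ → ℕ,
      q = ∑ k ∈ Finset.range N, (a (k + 1) : ℚ) / (pExt p k * pExt p (k + 2)) := by
  induction hq using AddSubmonoid.closure_induction with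
  | mem x hx =>
    obtain ⟨n, rfl⟩ := hx
    refine ⟨n + 3, fun N hN => ⟨Pi.single (n + 3) 1, ?_⟩⟩
    rw [Finset.sum_eq_single (n + 2)]
    · simp [pExt]
    · intro k _ hk
      rw [Pi.single_eq_of_ne (by omega)]
      simp
    · intro h
      exact absurd (Finset.mem_range.2 (by omega)) h
  | zero => exact ⟨0, fun N _ => ⟨0, by simp⟩⟩
  | add x y _ _ hx hy =>
    obtain ⟨A, hA⟩ := hx
    obtain ⟨B, hB⟩ := hy
    refine ⟨max A B, fun N hN => ?_⟩
    obtain ⟨a, ha⟩ := hA N (le_of_max_le_left hN)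
    obtain ⟨b, hb⟩ := hB N (le_of_max_le_right hN)
    exact ⟨a + b, by simp [ha, hb, add_div, Finset.sum_add_distrib]⟩

/-- Let `(pₙ)` be a strictly increasing sequence of primes (0-indexed here) and `M` the
2-prime reciprocal Puiseux monoid `⟨1/(pₙ pₙ₊₂) : n⟩`. If `q ∈ M` and `n` is the maximum
of `{0} ∪ {i ≥ 1 : v_{pᵢ}(q) < 0}` (paper indexing, i.e. paper's `pᵢ` is `p (i-1)`
here), then `q = c + Σ_{i=-1}^{n-2} c_{i+2}/(pᵢ pᵢ₊₂)` for some nonnegative integers `c`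
and `c₁, …, cₙ`, using the convention `p₋₁ = p₀ = 1`. -/
theorem twoPrimeReciprocal_decomposition (p : ℕ → ℕ)
    (hp : ∀ n, Nat.Prime (p n)) (hmono : StrictMono p)
    (M : AddSubmonoid ℚ)
    (hM : M = AddSubmonoid.closure
      {q : ℚ | ∃ n : ℕ, q = 1 / ((p n : ℚ) * (p (n + 2) : ℚ))})
    (q : ℚ) (hq : q ∈ M) (n : ℕ)
    (hn₁ : n = 0 ∨ (1 ≤ n ∧ padicValRat (p (n - 1)) q < 0))
    (hn₂ : ∀ i : ℕ, 1 ≤ i → padicValRat (p (i - 1)) q < 0 → i ≤ n) :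
    ∃ (c : ℕ) (cc : ℕ → ℕ),
      q = (c : ℚ) + ∑ k ∈ Finset.range n, (cc (k + 1) : ℚ) / (pExt p k * pExt p (k + 2)) := by
  subst hM
  obtain ⟨N₀, hN₀⟩ := exists_sum_of_mem_closure hq
  obtain ⟨a, ha⟩ := hN₀ (max n N₀) (le_max_right _ _)
  have descend : ∀ N, n ≤ N → (∃ (c : ℕ) (cc : ℕ → ℕ), q = (c : ℚ) +
      ∑ k ∈ Finset.range N, (cc (k + 1) : ℚ) / (pExt p k * pExt p (k + 2))) →
      ∃ (c : ℕ) (cc : ℕ → ℕ), q = (c : ℚ) +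
        ∑ k ∈ Finset.range n, (cc (k + 1) : ℚ) / (pExt p k * pExt p (k + 2)) := by
    intro N hN
    induction N, hN using Nat.le_induction with
    | base => exact id
    | succ N hN ih =>
      rintro ⟨c, a, h⟩
      apply ih
      have hv : 0 ≤ padicValRat (p N) q := by
        by_contra! hlt
        have := hn₂ (N + 1) (by omega) hlt
        omega
      obtain ⟨m, hm⟩ := dvd_last_coeff hp hmono.injective hv h
      obtain ⟨c', a', h'⟩ := exists_absorb_div_pExt hp N m c a
      refine ⟨c', a', ?_⟩
      have hpN : (p N : ℚ) ≠ 0 := mod_cast (hp N).ne_zero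
      rw [← h', h, Finset.sum_range_succ, hm, ← add_assoc,
        show pExt p (N + 2) = (p N : ℚ) from rfl, Nat.cast_mul, mul_comm (pExt p N),
        mul_div_mul_left _ _ hpN]
  exact descend _ (le_max_left _ _) ⟨0, a, by simpa using ha⟩
end
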